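/- Let V be an n-gon with general-position vertices sampled from a smooth curve as vⱼ = γ(x + (j−i)/n) with [γ'(x), γ''(x)] ≠ 0, and let U = T(V) be the pentagram image with uⱼ = Aⱼvⱼ + Bⱼv_{j+2} = Cⱼv_{j−1} + Dⱼv_{j+1}. Define T(Bᵢ) as the B-ratio computed from the polygon U, i.e. T(Bᵢ) = [u_{i−1}−uᵢ, uᵢ−u_{i+1}]/[u_{i−1}−u_{i+1}, uᵢ−u_{i+2}]. Then T(Bᵢ) = Bᵢ + O(1/n²) as n → ∞. -/

import Mathlib

open Filter Asymptotics

noncomputable section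

/-- The 2×2 determinant [u,v] = u₁v₂ − u₂v₁. -/
def det2 (u v : ℝ × ℝ) : ℝ := u.1 * v.2 - u.2 * v.1

/-- W = [γ', γ'''] / [γ', γ'']. -/
def Wc (γ : ℝ → ℝ × ℝ) (t : ℝ) : ℝ :=
  det2 (deriv γ t) (iteratedDeriv 3 γ t) / det2 (deriv γ t) (iteratedDeriv 2 γ t)

/-- A_i = [v_{i-1}-v_{i+1}, v_{i+1}-v_{i+2}] / [v_{i-1}-v_{i+1}, v_i-v_{i+2}]. -/
def Acoef (v : ℤ → ℝ × ℝ) (i : ℤ) : ℝ :=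
  det2 (v (i-1) - v (i+1)) (v (i+1) - v (i+2)) / det2 (v (i-1) - v (i+1)) (v i - v (i+2))

/-- B_i = [v_{i-1}-v_i, v_i-v_{i+1}] / [v_{i-1}-v_{i+1}, v_i-v_{i+2}]. -/
def Bcoef (v : ℤ → ℝ × ℝ) (i : ℤ) : ℝ :=
  det2 (v (i-1) - v i) (v i - v (i+1)) / det2 (v (i-1) - v (i+1)) (v i - v (i+2))

/-- C_i = [v_i-v_{i+1}, v_{i+1}-v_{i+2}] / [v_{i-1}-v_{i+1}, v_i-v_{i+2}]. -/
def Ccoef (v : ℤ → ℝ × ℝ) (i : ℤ) : ℝ :=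
  det2 (v i - v (i+1)) (v (i+1) - v (i+2)) / det2 (v (i-1) - v (i+1)) (v i - v (i+2))

/-- D_i = [v_{i-1}-v_i, v_i-v_{i+2}] / [v_{i-1}-v_{i+1}, v_i-v_{i+2}]. -/
def Dcoef (v : ℤ → ℝ × ℝ) (i : ℤ) : ℝ :=
  det2 (v (i-1) - v i) (v i - v (i+2)) / det2 (v (i-1) - v (i+1)) (v i - v (i+2))

/-- The pentagram map: u_i = A_i v_i + B_i v_{i+2}. -/
def pent (v : ℤ → ℝ × ℝ) (i : ℤ) : ℝ × ℝ :=
  Acoef v i • v i + Bcoef v i • v (i+2)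

/-- `f h = a + h b + O(h²)` as `h → 0`, `h ≠ 0`. -/
def HasFirstOrder {E : Type*} [NormedAddCommGroup E] [NormedSpace ℝ E]
    (f : ℝ → E) (a b : E) : Prop :=
  (fun h => f h - (a + h • b)) =O[nhdsWithin 0 {0}ᶜ] fun h : ℝ => h ^ 2

namespace HasFirstOrder

section NormedSpace

variable {E : Type*} [NormedAddCommGroup E] [NormedSpace ℝ E] {f g : ℝ → E} {a b c d : E}

theorem congr_coeffs (hf : HasFirstOrder f a b) (ha : a = c) (hb : b = d) :
    HasFirstOrder f c d := ha ▸ hb ▸ hf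

theorem add (hf : HasFirstOrder f a b) (hg : HasFirstOrder g c d) :
    HasFirstOrder (fun h => f h + g h) (a + c) (b + d) := by
  refine (IsBigO.add hf hg).congr_left fun h => ?_
  module

theorem sub (hf : HasFirstOrder f a b) (hg : HasFirstOrder g c d) :
    HasFirstOrder (fun h => f h - g h) (a - c) (b - d) := by
  refine (IsBigO.sub hf hg).congr_left fun h => ?_
  module

theorem tendsto (hf : HasFirstOrder f a b) :
    Tendsto f (nhdsWithin 0 {0}ᶜ) (nhds a) := by
  have h₁ : Tendsto (fun h => f h - (a + h • b)) (nhdsWithin 0 {0}ᶜ) (nhds 0) := by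
    refine hf.trans_tendsto ?_
    have : ContinuousAt (fun h : ℝ => h ^ 2) 0 := by fun_prop
    simpa using this.tendsto.mono_left nhdsWithin_le_nhds
  have h₂ : Tendsto (fun h : ℝ => a + h • b) (nhdsWithin 0 {0}ᶜ) (nhds a) := by
    have : ContinuousAt (fun h : ℝ => a + h • b) 0 := by fun_prop
    simpa using this.tendsto.mono_left nhdsWithin_le_nhds
  simpa using h₁.add h₂

theorem smul {k : ℝ → ℝ} {p q : ℝ} (hk : HasFirstOrder k p q) (hf : HasFirstOrder f a b) :
    HasFirstOrder (fun h => k h • f h) (p • a) (p • b + q • a) := by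
  have h₁ : (fun h => (k h - (p + h • q)) • f h) =O[nhdsWithin 0 {0}ᶜ] fun h : ℝ => h ^ 2 := by
    simpa using IsBigO.smul hk (hf.tendsto.isBigO_one ℝ)
  have h₂ : (fun h => (p + h * q) • (f h - (a + h • b)))
      =O[nhdsWithin 0 {0}ᶜ] fun h : ℝ => h ^ 2 := by
    have hb : (fun h : ℝ => p + h * q) =O[nhdsWithin 0 {0}ᶜ] fun _ => (1 : ℝ) := by
      have : ContinuousAt (fun h : ℝ => p + h * q) 0 := by fun_prop
      exact (this.tendsto.mono_left nhdsWithin_le_nhds).isBigO_one ℝ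
    simpa using hb.smul hf
  have h₃ : (fun h : ℝ => h ^ 2 • (q • b)) =O[nhdsWithin 0 {0}ᶜ] fun h : ℝ => h ^ 2 := by
    simpa using (isBigO_refl (fun h : ℝ => h ^ 2) _).smul
      (isBigO_const_const (q • b) (one_ne_zero (α := ℝ)) _)
  refine ((h₁.add h₂).add h₃).congr_left fun h => ?_
  simp only [smul_eq_mul]
  module

end NormedSpace

theorem inv {f : ℝ → ℝ} {a b : ℝ} (hf : HasFirstOrder f a b) (ha : a ≠ 0) :
    HasFirstOrder (fun h => (f h)⁻¹) a⁻¹ (-b / a ^ 2) := by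
  have hne := hf.tendsto.eventually_ne ha
  have hinv := (hf.tendsto.inv₀ ha).isBigO_one ℝ
  have hc : (fun h : ℝ => -(a - h * b) / a ^ 2) =O[nhdsWithin 0 {0}ᶜ] fun _ => (1 : ℝ) := by
    have : ContinuousAt (fun h : ℝ => -(a - h * b) / a ^ 2) 0 := by fun_prop
    exact (this.tendsto.mono_left nhdsWithin_le_nhds).isBigO_one ℝ
  have h₁ : (fun h => (f h)⁻¹ * ((f h - (a + h * b)) * (-(a - h * b) / a ^ 2)
      + h ^ 2 * (b ^ 2 / a ^ 2))) =O[nhdsWithin 0 {0}ᶜ] fun h : ℝ => h ^ 2 := by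
    have h₂ : (fun h => (f h - (a + h * b)) * (-(a - h * b) / a ^ 2))
        =O[nhdsWithin 0 {0}ᶜ] fun h : ℝ => h ^ 2 := by
      simpa using IsBigO.mul hf hc
    have h₃ : (fun h : ℝ => h ^ 2 * (b ^ 2 / a ^ 2))
        =O[nhdsWithin 0 {0}ᶜ] fun h : ℝ => h ^ 2 := by
      simpa using (isBigO_refl (fun h : ℝ => h ^ 2) _).mul
        (isBigO_const_const (b ^ 2 / a ^ 2) (one_ne_zero (α := ℝ)) _)
    simpa using hinv.mul (h₂.add h₃)
  refine h₁.congr' ?_ EventuallyEq.rfl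
  filter_upwards [hne] with h hh
  simp only [smul_eq_mul]
  field_simp
  ring

theorem div {f g : ℝ → ℝ} {a b c d : ℝ} (hf : HasFirstOrder f a b)
    (hg : HasFirstOrder g c d) (hc : c ≠ 0) :
    HasFirstOrder (fun h => f h / g h) (a / c) (b / c - a * d / c ^ 2) := by
  simp only [div_eq_mul_inv (f _)]
  refine (hf.smul (hg.inv hc)).congr_coeffs ?_ ?_ <;> simp only [smul_eq_mul] <;> ring

theorem mul {f g : ℝ → ℝ} {a b c d : ℝ} (hf : HasFirstOrder f a b)
    (hg : HasFirstOrder g c d) :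
    HasFirstOrder (fun h => f h * g h) (a * c) (a * d + b * c) :=
  hf.smul hg

theorem prodMk {f g : ℝ → ℝ} {a b c d : ℝ} (hf : HasFirstOrder f a b)
    (hg : HasFirstOrder g c d) :
    HasFirstOrder (fun h => (f h, g h)) (a, c) (b, d) :=
  IsBigO.prod_left hf hg

theorem fst {f : ℝ → ℝ × ℝ} {a b : ℝ × ℝ} (hf : HasFirstOrder f a b) :
    HasFirstOrder (fun h => (f h).1) a.1 b.1 :=
  (isBigO_fst_prod' (f' := fun h => f h - (a + h • b))).trans hf

theorem snd {f : ℝ → ℝ × ℝ} {a b : ℝ × ℝ} (hf : HasFirstOrder f a b) :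
    HasFirstOrder (fun h => (f h).2) a.2 b.2 :=
  (isBigO_snd_prod' (f' := fun h => f h - (a + h • b))).trans hf

theorem det2 {f g : ℝ → ℝ × ℝ} {a b c d : ℝ × ℝ} (hf : HasFirstOrder f a b)
    (hg : HasFirstOrder g c d) :
    HasFirstOrder (fun h => det2 (f h) (g h)) (det2 a c) (det2 a d + det2 b c) := by
  refine ((hf.fst.mul hg.snd).sub (hf.snd.mul hg.fst)).congr_coeffs rfl ?_
  simp only [_root_.det2]; ring

end HasFirstOrder

theorem det2_smul_add_smul (e₁ e₂ p q : ℝ × ℝ) :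
    det2 (p.1 • e₁ + p.2 • e₂) (q.1 • e₁ + q.2 • e₂) = det2 p q * det2 e₁ e₂ := by
  simp only [det2, Prod.fst_add, Prod.snd_add, Prod.smul_fst, Prod.smul_snd, smul_eq_mul]
  ring

theorem Acoef_add_Bcoef (v : ℤ → ℝ × ℝ) (i : ℤ)
    (h : det2 (v (i-1) - v (i+1)) (v i - v (i+2)) ≠ 0) : Acoef v i + Bcoef v i = 1 := by
  rw [Acoef, Bcoef, ← add_div, div_eq_one_iff_eq h]
  simp only [det2, Prod.fst_sub, Prod.snd_sub]
  ring

/-- The affine map with the given origin and axes. -/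
def affineFrame (o e₁ e₂ p : ℝ × ℝ) : ℝ × ℝ := o + (p.1 • e₁ + p.2 • e₂)

theorem det2_affineFrame_sub (o e₁ e₂ p q r s : ℝ × ℝ) :
    det2 (affineFrame o e₁ e₂ p - affineFrame o e₁ e₂ q)
        (affineFrame o e₁ e₂ r - affineFrame o e₁ e₂ s)
      = det2 (p - q) (r - s) * det2 e₁ e₂ := by
  rw [← det2_smul_add_smul]
  congr 1 <;> simp only [affineFrame, Prod.fst_sub, Prod.snd_sub] <;> module

section Affine

variable {o e₁ e₂ : ℝ × ℝ}

theorem Acoef_affineFrame (he : det2 e₁ e₂ ≠ 0) (p : ℤ → ℝ × ℝ) (i : ℤ) :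
    Acoef (fun j => affineFrame o e₁ e₂ (p j)) i = Acoef p i := by
  simp only [Acoef, det2_affineFrame_sub, mul_div_mul_right _ _ he]

theorem Bcoef_affineFrame (he : det2 e₁ e₂ ≠ 0) (p : ℤ → ℝ × ℝ) (i : ℤ) :
    Bcoef (fun j => affineFrame o e₁ e₂ (p j)) i = Bcoef p i := by
  simp only [Bcoef, det2_affineFrame_sub, mul_div_mul_right _ _ he]

theorem pent_affineFrame (he : det2 e₁ e₂ ≠ 0) (p : ℤ → ℝ × ℝ) (i : ℤ)
    (hi : det2 (p (i-1) - p (i+1)) (p i - p (i+2)) ≠ 0) :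
    pent (fun j => affineFrame o e₁ e₂ (p j)) i = affineFrame o e₁ e₂ (pent p i) := by
  rw [pent, Acoef_affineFrame he, Bcoef_affineFrame he, pent,
    eq_sub_of_add_eq (Acoef_add_Bcoef p i hi)]
  simp only [affineFrame, Prod.fst_add, Prod.snd_add, Prod.smul_fst, Prod.smul_snd, smul_eq_mul]
  module

end Affine

theorem Bcoef_congr {v w : ℤ → ℝ × ℝ} {i : ℤ} (h₁ : v (i-1) = w (i-1)) (h₂ : v i = w i)
    (h₃ : v (i+1) = w (i+1)) (h₄ : v (i+2) = w (i+2)) : Bcoef v i = Bcoef w i := by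
  simp only [Bcoef, h₁, h₂, h₃, h₄]

section Cubic

variable {p : ℝ → ℤ → ℝ × ℝ} {w : ℝ}

theorem hasFirstOrder_denom
    (hp : ∀ j : ℤ, HasFirstOrder (fun h => p h j) ((j : ℝ), (j : ℝ) ^ 2 / 2) (0, w * j ^ 3 / 6))
    (i : ℤ) :
    HasFirstOrder (fun h => det2 (p h (i-1) - p h (i+1)) (p h i - p h (i+2)))
      4 (w * (4 * i + 2)) := by
  refine (((hp _).sub (hp _)).det2 ((hp _).sub (hp _))).congr_coeffs ?_ ?_ <;>
    simp only [det2, Prod.fst_sub, Prod.snd_sub] <;> push_cast <;> ring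

theorem hasFirstOrder_Bcoef
    (hp : ∀ j : ℤ, HasFirstOrder (fun h => p h j) ((j : ℝ), (j : ℝ) ^ 2 / 2) (0, w * j ^ 3 / 6))
    (i : ℤ) :
    HasFirstOrder (fun h => Bcoef (p h) i) (1 / 4) (-w / 8) := by
  refine ((((hp _).sub (hp _)).det2 ((hp _).sub (hp _))).div
    (hasFirstOrder_denom hp i) (by norm_num)).congr_coeffs ?_ ?_ <;>
    simp only [det2, Prod.fst_sub, Prod.snd_sub] <;> push_cast <;> ring

theorem hasFirstOrder_Acoef
    (hp : ∀ j : ℤ, HasFirstOrder (fun h => p h j) ((j : ℝ), (j : ℝ) ^ 2 / 2) (0, w * j ^ 3 / 6))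
    (i : ℤ) :
    HasFirstOrder (fun h => Acoef (p h) i) (3 / 4) (w / 8) := by
  refine ((((hp _).sub (hp _)).det2 ((hp _).sub (hp _))).div
    (hasFirstOrder_denom hp i) (by norm_num)).congr_coeffs ?_ ?_ <;>
    simp only [det2, Prod.fst_sub, Prod.snd_sub] <;> push_cast <;> ring

theorem hasFirstOrder_pent
    (hp : ∀ j : ℤ, HasFirstOrder (fun h => p h j) ((j : ℝ), (j : ℝ) ^ 2 / 2) (0, w * j ^ 3 / 6))
    (i : ℤ) :
    HasFirstOrder (fun h => pent (p h) i)
      (i + 1 / 2, 3 / 8 * (i : ℝ) ^ 2 + (i + 2) ^ 2 / 8)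
      (-w / 4, -w * (i + 1) / 4 + w / 24 * (3 * (i : ℝ) ^ 3 + (i + 2) ^ 3)) := by
  refine (((hasFirstOrder_Acoef hp i).smul (hp _)).add
    ((hasFirstOrder_Bcoef hp i).smul (hp _))).congr_coeffs ?_ ?_ <;> ext <;>
    simp only [Prod.fst_add, Prod.snd_add, Prod.smul_fst, Prod.smul_snd, smul_eq_mul] <;>
    push_cast <;> ring

theorem hasFirstOrder_Bcoef_pent
    (hp : ∀ j : ℤ, HasFirstOrder (fun h => p h j) ((j : ℝ), (j : ℝ) ^ 2 / 2) (0, w * j ^ 3 / 6))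
    (i : ℤ) :
    HasFirstOrder (fun h => Bcoef (pent (p h)) i) (1 / 4) (-w / 8) := by
  have hu := hasFirstOrder_pent hp
  have hd : HasFirstOrder (fun h => det2 (pent (p h) (i-1) - pent (p h) (i+1))
      (pent (p h) i - pent (p h) (i+2))) 4 (w * (4 * i + 4)) := by
    refine (((hu _).sub (hu _)).det2 ((hu _).sub (hu _))).congr_coeffs ?_ ?_ <;>
      simp only [det2, Prod.fst_sub, Prod.snd_sub] <;> push_cast <;> ring
  refine ((((hu _).sub (hu _)).det2 ((hu _).sub (hu _))).div
    hd (by norm_num)).congr_coeffs ?_ ?_ <;>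
    simp only [det2, Prod.fst_sub, Prod.snd_sub] <;> push_cast <;> ring

theorem isBigO_Bcoef_pent_sub
    (hp : ∀ j : ℤ, HasFirstOrder (fun h => p h j) ((j : ℝ), (j : ℝ) ^ 2 / 2) (0, w * j ^ 3 / 6))
    (i : ℤ) :
    (fun h => Bcoef (pent (p h)) i - Bcoef (p h) i)
      =O[nhdsWithin 0 {0}ᶜ] fun h : ℝ => h ^ 2 := by
  refine (IsBigO.sub (hasFirstOrder_Bcoef_pent hp i) (hasFirstOrder_Bcoef hp i)).congr_left
    fun h => ?_
  abel

end Cubic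

theorem taylor_isBigO_four {γ : ℝ → ℝ × ℝ} (hγ : ContDiff ℝ 4 γ) (x c : ℝ) :
    (fun h : ℝ => γ (x + c * h) - (γ x + (c * h) • deriv γ x
        + ((c * h) ^ 2 / 2) • iteratedDeriv 2 γ x + ((c * h) ^ 3 / 6) • iteratedDeriv 3 γ x))
      =O[nhds 0] fun h : ℝ => h ^ 4 := by
  have ht : Tendsto (fun h : ℝ => x + c * h) (nhds 0) (nhds x) := by
    have : ContinuousAt (fun h : ℝ => x + c * h) 0 := by fun_prop
    simpa using this.tendsto
  have h₁ := ((taylor_isLittleO_univ (x₀ := x) (n := 4) hγ).comp_tendsto ht).isBigO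
  have h₂ : (fun h : ℝ => h ^ 4 • ((c ^ 4 / 24) • iteratedDeriv 4 γ x))
      =O[nhds 0] fun h : ℝ => h ^ 4 := by
    simpa only [smul_eq_mul, mul_one] using (isBigO_refl (fun h : ℝ => h ^ 4) _).smul
      (isBigO_const_const ((c ^ 4 / 24) • iteratedDeriv 4 γ x) (one_ne_zero (α := ℝ)) _)
  have h₃ : ((fun t => (t - x) ^ 4) ∘ fun h : ℝ => x + c * h)
      =O[nhds 0] fun h : ℝ => h ^ 4 := by
    refine (isBigO_const_mul_self (c ^ 4) (fun h : ℝ => h ^ 4) _).congr_left fun h => ?_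
    simp only [Function.comp_apply]; ring
  refine ((h₁.trans h₃).add h₂).congr_left fun h => ?_
  simp only [Function.comp_apply, taylorWithinEval_succ, taylor_within_zero_eval,
    iteratedDerivWithin_univ, ← iteratedDeriv_one, Nat.factorial]
  norm_num
  module

/-- Coordinates of `w` in the frame `(h • e₁, h² • e₂)`. -/
def scaledCoords (e₁ e₂ : ℝ × ℝ) (h : ℝ) (w : ℝ × ℝ) : ℝ × ℝ :=
  (h⁻¹ * (det2 w e₂ / det2 e₁ e₂), (h ^ 2)⁻¹ * (det2 e₁ w / det2 e₁ e₂))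

theorem affineFrame_scaledCoords {e₁ e₂ : ℝ × ℝ} (he : det2 e₁ e₂ ≠ 0) {h : ℝ} (hh : h ≠ 0)
    (o v : ℝ × ℝ) :
    affineFrame o (h • e₁) (h ^ 2 • e₂) (scaledCoords e₁ e₂ h (v - o)) = v := by
  ext <;>
    simp only [affineFrame, scaledCoords, Prod.fst_add, Prod.snd_add, Prod.smul_fst,
      Prod.smul_snd, smul_eq_mul] <;> field_simp <;>
    simp only [det2, Prod.fst_sub, Prod.snd_sub] <;> ring

theorem det2_isBigO_left {f : ℝ → ℝ × ℝ} {l : Filter ℝ} {g : ℝ → ℝ} (hf : f =O[l] g)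
    (e : ℝ × ℝ) : (fun h => det2 (f h) e) =O[l] g := by
  refine IsBigO.sub ?_ ?_
  · simpa only [mul_comm] using (isBigO_fst_prod'.trans hf).const_mul_left e.2
  · simpa only [mul_comm] using (isBigO_snd_prod'.trans hf).const_mul_left e.1

theorem hasFirstOrder_scaledCoords {γ : ℝ → ℝ × ℝ} (hγ : ContDiff ℝ 4 γ) {x : ℝ}
    (hnd : det2 (deriv γ x) (iteratedDeriv 2 γ x) ≠ 0) (c : ℝ) :
    HasFirstOrder
      (fun h => scaledCoords (deriv γ x) (iteratedDeriv 2 γ x) h (γ (x + c * h) - γ x))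
      (c, c ^ 2 / 2) (0, Wc γ x * c ^ 3 / 6) := by
  have hT := (taylor_isBigO_four hγ x c).mono (nhdsWithin_le_nhds (s := {0}ᶜ))
  simp only [Wc]
  set e₁ := deriv γ x
  set e₂ := iteratedDeriv 2 γ x
  set e₃ := iteratedDeriv 3 γ x
  set R := fun h : ℝ => γ (x + c * h) - (γ x + (c * h) • e₁
        + ((c * h) ^ 2 / 2) • e₂ + ((c * h) ^ 3 / 6) • e₃) with hR
  have hne : ∀ᶠ h : ℝ in nhdsWithin 0 {0}ᶜ, h ≠ 0 := self_mem_nhdsWithin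
  have hdecomp : ∀ h, γ (x + c * h) - γ x = (c * h) • e₁
        + ((c * h) ^ 2 / 2) • e₂ + ((c * h) ^ 3 / 6) • e₃ + R h := by
    intro h; simp only [hR]; abel
  have hpow : (fun h : ℝ => h ^ 3) =O[nhdsWithin 0 {0}ᶜ] fun h : ℝ => h ^ 2 :=
    (isLittleO_pow_pow (by norm_num : 2 < 3)).isBigO.mono nhdsWithin_le_nhds
  refine HasFirstOrder.prodMk ?_ ?_
  · have h₁ : (fun h => h⁻¹ * ((det2 e₁ e₂)⁻¹ * det2 (R h) e₂))
        =O[nhdsWithin 0 {0}ᶜ] fun h : ℝ => h ^ 2 := by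
      refine IsBigO.trans ?_ hpow
      refine ((isBigO_refl (fun h : ℝ => h⁻¹) _).mul
        ((det2_isBigO_left hT e₂).const_mul_left _)).congr' EventuallyEq.rfl ?_
      filter_upwards [hne] with h hh
      field_simp
    have h₂ := (isBigO_refl (fun h : ℝ => h ^ 2) (nhdsWithin 0 {0}ᶜ)).const_mul_left
      (c ^ 3 / 6 * det2 e₃ e₂ / det2 e₁ e₂)
    refine (h₁.add h₂).congr' ?_ EventuallyEq.rfl
    filter_upwards [hne] with h hh
    rw [hdecomp]
    simp only [smul_eq_mul]
    field_simp
    simp only [det2, Prod.fst_add, Prod.snd_add, Prod.smul_fst, Prod.smul_snd, smul_eq_mul]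
    ring
  · have h₁ : (fun h => (h ^ 2)⁻¹ * (-(det2 e₁ e₂)⁻¹ * det2 (R h) e₁))
        =O[nhdsWithin 0 {0}ᶜ] fun h : ℝ => h ^ 2 := by
      refine ((isBigO_refl (fun h : ℝ => (h ^ 2)⁻¹) _).mul
        ((det2_isBigO_left hT e₁).const_mul_left _)).congr' EventuallyEq.rfl ?_
      filter_upwards [hne] with h hh
      field_simp
    refine h₁.congr' ?_ EventuallyEq.rfl
    filter_upwards [hne] with h hh
    rw [hdecomp]
    simp only [smul_eq_mul]
    field_simp
    simp only [det2, Prod.fst_add, Prod.snd_add, Prod.smul_fst, Prod.smul_snd, smul_eq_mul]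
    ring

theorem stmt13 (γ : ℝ → ℝ × ℝ) (hγ : ContDiff ℝ 4 γ) (x : ℝ)
    (hnd : det2 (deriv γ x) (iteratedDeriv 2 γ x) ≠ 0) :
    (fun n : ℕ =>
        Bcoef (pent (fun j : ℤ => γ (x + (j:ℝ) / n))) 0
          - Bcoef (fun j : ℤ => γ (x + (j:ℝ) / n)) 0)
      =O[atTop] fun n : ℕ => (1:ℝ)/(n:ℝ)^2 := by
  let p : ℝ → ℤ → ℝ × ℝ := fun h j =>
    scaledCoords (deriv γ x) (iteratedDeriv 2 γ x) h (γ (x + j * h) - γ x)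
  have hp : ∀ j : ℤ, HasFirstOrder (fun h => p h j) ((j : ℝ), (j : ℝ) ^ 2 / 2)
      (0, Wc γ x * j ^ 3 / 6) := fun j => hasFirstOrder_scaledCoords hγ hnd j
  have hden (i : ℤ) := (hasFirstOrder_denom hp i).tendsto.eventually_ne four_ne_zero
  have hne : ∀ᶠ h : ℝ in nhdsWithin 0 {0}ᶜ, h ≠ 0 := self_mem_nhdsWithin
  have key : (fun h : ℝ => Bcoef (pent (fun j : ℤ => γ (x + j * h))) 0
      - Bcoef (fun j : ℤ => γ (x + j * h)) 0) =O[nhdsWithin 0 {0}ᶜ] fun h : ℝ => h ^ 2 := by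
    refine (isBigO_Bcoef_pent_sub hp 0).congr' ?_ EventuallyEq.rfl
    filter_upwards [hne, hden (0 - 1), hden 0, hden (0 + 1), hden (0 + 2)] with h hh d₁ d₂ d₃ d₄
    have hframe : (fun j : ℤ => γ (x + j * h)) = fun j => affineFrame (γ x) (h • deriv γ x)
        (h ^ 2 • iteratedDeriv 2 γ x) (p h j) :=
      funext fun j => (affineFrame_scaledCoords hnd hh _ _).symm
    have he : det2 (h • deriv γ x) (h ^ 2 • iteratedDeriv 2 γ x) ≠ 0 := by
      have : det2 (h • deriv γ x) (h ^ 2 • iteratedDeriv 2 γ x)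
          = h ^ 3 * det2 (deriv γ x) (iteratedDeriv 2 γ x) := by
        simp only [det2, Prod.smul_fst, Prod.smul_snd, smul_eq_mul]; ring
      rw [this]
      exact mul_ne_zero (pow_ne_zero _ hh) hnd
    rw [hframe, Bcoef_affineFrame he, ← Bcoef_affineFrame he (pent (p h)) (o := γ x)]
    congr 1
    exact (Bcoef_congr (pent_affineFrame he _ _ d₁) (pent_affineFrame he _ _ d₂)
      (pent_affineFrame he _ _ d₃) (pent_affineFrame he _ _ d₄)).symm
  have hlim : Tendsto (fun n : ℕ => (n : ℝ)⁻¹) atTop (nhdsWithin 0 {0}ᶜ) := by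
    refine tendsto_nhdsWithin_iff.2 ⟨tendsto_inv_atTop_nhds_zero_nat, ?_⟩
    filter_upwards [eventually_ne_atTop 0] with n hn
    simpa using hn
  simpa only [Function.comp_def, div_eq_mul_inv, one_mul, inv_pow] using key.comp_tendsto hlim
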